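/- arXiv:1004.1221 — 2 statements merged into one kernel-verified Lean document; each statement's English description precedes it below -/
import Mathlib

section
/- There is a constant C such that for all ν > 0, s ≥ 0, τ ∈ ℝ and z ∈ ℝ, the principal-value integral K(τ,z) = lim_{R→∞} lim_{ε→0⁺} ∫_{ε ≤ |ξ| ≤ R} e^{izξ} · ξ / (τ + ξ² - iν(ξ² + s)) dξ exists and satisfies |K(τ,z)| ≤ C. -/
open MeasureTheory

noncomputable section

/-- `e r = exp (i r)`. -/
def e (r : ℝ) : ℂ := Complex.exp (Complex.I * (r : ℂ))

open Set Filter Topology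

/-- Folding an integral over the line onto the positive half-line. -/
lemma integral_eq_integral_Ioi_add_comp_neg {f : ℝ → ℂ} (hf : Integrable f) :
    ∫ x, f x = ∫ x in Ioi (0 : ℝ), (f x + f (-x)) := by
  have hneg := integral_comp_neg_Ioi (0 : ℝ) f
  rw [neg_zero] at hneg
  rw [integral_add hf.integrableOn hf.comp_neg.integrableOn, hneg, add_comm,
    intervalIntegral.integral_Iic_add_Ioi hf.integrableOn hf.integrableOn]

lemma MeasureTheory.IntegrableOn.integrable_comp_abs {f : ℝ → ℝ} (hf : IntegrableOn f (Ioi 0)) :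
    Integrable fun x => f |x| := by
  have hpos : IntegrableOn (fun x => f |x|) (Ioi 0) :=
    hf.congr_fun (fun x hx => by rw [abs_of_pos (mem_Ioi.1 hx)]) measurableSet_Ioi
  have hneg : IntegrableOn (fun x => f |x|) (Iic 0) := by
    rw [integrableOn_Iic_iff_integrableOn_Iio]
    simpa using IntegrableOn.comp_neg_Iio (c := (0 : ℝ)) (f := fun x => f |x|) (by simpa using hpos)
  simpa using hneg.union hpos

lemma integrableOn_mul_exp_neg_mul {c : ℝ} (hc : 0 < c) :
    IntegrableOn (fun t : ℝ => t * Real.exp (-c * t)) (Ioi 0) := by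
  have h := integrableOn_rpow_mul_exp_neg_mul_rpow (p := 1) (s := 1) (b := c)
    (by norm_num) one_pos hc
  simpa using h

lemma integrable_abs_mul_cexp_neg_mul_abs {μ : ℂ} (hμ : 0 < μ.re) :
    Integrable (fun t : ℝ => ((|t| : ℝ) : ℂ) * Complex.exp (-μ * |t|)) := by
  have h := integrableOn_mul_exp_neg_mul hμ
  have h1 : Integrable (fun t : ℝ => |t| * Real.exp (-μ.re * |t|)) :=
    h.integrable_comp_abs (f := fun t => t * Real.exp (-μ.re * t))
  refine h1.mono' (by fun_prop) (ae_of_all _ fun t => ?_)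
  simp [Complex.norm_exp]

lemma integrableOn_mul_cexp_neg_mul {p : ℂ} (hp : 0 < p.re) :
    IntegrableOn (fun t : ℝ => (t : ℂ) * Complex.exp (-p * t)) (Ioi 0) := by
  refine (integrable_abs_mul_cexp_neg_mul_abs hp).integrableOn.congr_fun (fun t ht => ?_)
    measurableSet_Ioi
  simp [abs_of_pos (mem_Ioi.1 ht)]

lemma integral_mul_cexp_neg_mul {p : ℂ} (hp : 0 < p.re) :
    ∫ t : ℝ in Ioi 0, (t : ℂ) * Complex.exp (-p * t) = 1 / p ^ 2 := by
  have hp0 : p ≠ 0 := by rintro rfl; simp at hp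
  have hd : ∀ t ∈ Ici (0 : ℝ),
      HasDerivAt (fun t : ℝ => -((t : ℂ) / p + 1 / p ^ 2) * Complex.exp (-p * t))
        ((t : ℂ) * Complex.exp (-p * t)) t := fun t _ => by
    have h1 : HasDerivAt (fun t : ℂ => -(t / p + 1 / p ^ 2) * Complex.exp (-p * t))
        (-(1 / p) * Complex.exp (-p * t) +
          -((t : ℂ) / p + 1 / p ^ 2) * (Complex.exp (-p * t) * (-p * 1))) t :=
      (((hasDerivAt_id (t : ℂ)).div_const p).add_const (1 / p ^ 2)).neg.mul
        ((hasDerivAt_id (t : ℂ)).const_mul (-p)).cexp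
    convert h1.comp_ofReal using 1
    field_simp
    ring
  have ht : Tendsto (fun t : ℝ => -((t : ℂ) / p + 1 / p ^ 2) * Complex.exp (-p * t))
      atTop (𝓝 0) := by
    have h0 : Tendsto (fun t : ℝ => Complex.exp (-p * t)) atTop (𝓝 0) := by
      rw [tendsto_zero_iff_norm_tendsto_zero]
      simp only [Complex.norm_exp]
      refine Real.tendsto_exp_atBot.comp ?_
      simpa using tendsto_id.const_mul_atTop hp
    have h1 : Tendsto (fun t : ℝ => (t : ℂ) * Complex.exp (-p * t)) atTop (𝓝 0) := by
      rw [tendsto_zero_iff_norm_tendsto_zero]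
      have h2 := tendsto_rpow_mul_exp_neg_mul_atTop_nhds_zero 1 p.re hp
      refine h2.congr' ?_
      filter_upwards [eventually_ge_atTop 0] with t ht
      simp [Complex.norm_exp, abs_of_nonneg ht]
    have h3 := (h1.const_mul (-(1 / p))).add (h0.const_mul (-(1 / p ^ 2)))
    simp only [mul_zero, add_zero] at h3
    refine h3.congr fun t => ?_
    ring
  have := integral_Ioi_of_hasDerivAt_of_tendsto' hd (integrableOn_mul_cexp_neg_mul hp) ht
  rw [this]
  simp

lemma add_I_mul_ne_zero {μ : ℂ} (hμ : 0 < μ.re) (ξ : ℝ) : μ + Complex.I * ξ ≠ 0 := fun h => by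
  have := congrArg Complex.re h
  simp at this
  exact hμ.ne' this

lemma integrable_inv_add_I_mul_sq {μ : ℂ} (hμ : 0 < μ.re) :
    Integrable (fun ξ : ℝ => 1 / (μ + Complex.I * ξ) ^ 2) := by
  have h1 := ((integrable_inv_one_add_sq.comp_div hμ.ne').comp_add_left μ.im).const_mul
    ((μ.re ^ 2)⁻¹)
  have hne : ∀ ξ : ℝ, (μ + Complex.I * ξ) ^ 2 ≠ 0 := fun ξ =>
    pow_ne_zero 2 (add_I_mul_ne_zero hμ ξ)
  refine h1.mono' (Continuous.aestronglyMeasurable (by fun_prop (disch := exact hne _)))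
    (ae_of_all _ fun ξ => le_of_eq ?_)
  rw [norm_div, norm_one, norm_pow, ← Complex.normSq_eq_norm_sq, Complex.normSq_apply]
  have : μ.re ^ 2 + (μ.im + ξ) ^ 2 ≠ 0 := by positivity
  simp
  field_simp

/-- `1 / (μ + iξ)² + 1 / (μ - iξ)²`, twice the derivative of `ξ / (ξ² + μ²)`. -/
def cauchyKernel (μ : ℂ) (ξ : ℝ) : ℂ :=
  1 / (μ + Complex.I * ξ) ^ 2 + 1 / (μ - Complex.I * ξ) ^ 2

lemma cauchyKernel_neg (μ : ℂ) (ξ : ℝ) : cauchyKernel μ (-ξ) = cauchyKernel μ ξ := by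
  simp only [cauchyKernel, Complex.ofReal_neg, mul_neg, sub_neg_eq_add, ← sub_eq_add_neg]
  exact add_comm _ _

lemma integrable_cauchyKernel {μ : ℂ} (hμ : 0 < μ.re) : Integrable (cauchyKernel μ) := by
  have h := integrable_inv_add_I_mul_sq hμ
  refine h.add (h.comp_neg.congr (ae_of_all _ fun ξ => ?_))
  simp [sub_eq_add_neg]

lemma fourier_abs_mul_cexp_neg_mul_abs {μ : ℂ} (hμ : 0 < μ.re) :
    FourierTransform.fourier (fun t : ℝ => ((|t| : ℝ) : ℂ) * Complex.exp (-μ * |t|)) =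
      fun x : ℝ => cauchyKernel μ (2 * Real.pi * x) := by
  ext x
  have hi := integrable_abs_mul_cexp_neg_mul_abs hμ
  rw [Real.fourier_real_eq_integral_exp_smul]
  have hi2 : Integrable (fun v : ℝ => Complex.exp ((-2 * Real.pi * v * x : ℝ) * Complex.I) •
      (((|v| : ℝ) : ℂ) * Complex.exp (-μ * |v|))) := by
    refine hi.norm.mono' (by fun_prop) (ae_of_all _ fun t => ?_)
    rw [norm_smul, Complex.norm_exp_ofReal_mul_I, one_mul]
  rw [integral_eq_integral_Ioi_add_comp_neg hi2]
  have e1 : 0 < (μ + Complex.I * (2 * Real.pi * x : ℝ)).re := by simpa using hμ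
  have e2 : 0 < (μ - Complex.I * (2 * Real.pi * x : ℝ)).re := by simpa using hμ
  rw [cauchyKernel, ← integral_mul_cexp_neg_mul e1, ← integral_mul_cexp_neg_mul e2,
    ← integral_add (integrableOn_mul_cexp_neg_mul e1) (integrableOn_mul_cexp_neg_mul e2)]
  refine setIntegral_congr_fun measurableSet_Ioi fun t ht => ?_
  simp only [abs_neg, abs_of_pos (mem_Ioi.1 ht), smul_eq_mul]
  rw [mul_left_comm, mul_left_comm (Complex.exp _), ← Complex.exp_add, ← Complex.exp_add]
  congr 3 <;> push_cast <;> ring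

lemma integral_cexp_mul_cauchyKernel {μ : ℂ} (hμ : 0 < μ.re) (z : ℝ) :
    ∫ ξ : ℝ, Complex.exp (Complex.I * (z * ξ : ℝ)) * cauchyKernel μ ξ =
      2 * Real.pi * (|z| * Complex.exp (-μ * |z|)) := by
  have hi := integrable_abs_mul_cexp_neg_mul_abs hμ
  have hF := fourier_abs_mul_cexp_neg_mul_abs hμ
  have hpi : (2 * Real.pi) ≠ 0 := by positivity
  have hinv := Continuous.fourierInv_fourier_eq
    (f := fun t : ℝ => ((|t| : ℝ) : ℂ) * Complex.exp (-μ * |t|)) (by fun_prop) hi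
    (by rw [hF]; exact (integrable_cauchyKernel hμ).comp_mul_left' hpi)
  have h2 := congrFun hinv z
  rw [hF, Real.fourierInv_eq'] at h2
  have h3 := Measure.integral_comp_mul_left
    (fun ξ : ℝ => Complex.exp (Complex.I * (z * ξ : ℝ)) * cauchyKernel μ ξ) (2 * Real.pi)
  rw [← h2, eq_comm]
  have : ∀ v : ℝ, Complex.exp ((2 * Real.pi * inner ℝ v z : ℝ) * Complex.I) •
      cauchyKernel μ (2 * Real.pi * v) =
      Complex.exp (Complex.I * (z * (2 * Real.pi * v) : ℝ)) *
        cauchyKernel μ (2 * Real.pi * v) := fun v => by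
    rw [smul_eq_mul]
    congr 2
    simp
    ring
  simp only [this]
  rw [h3, abs_of_pos (by positivity), Complex.real_smul]
  push_cast
  field_simp

lemma integral_cos_mul_cauchyKernel {μ : ℂ} (hμ : 0 < μ.re) (z : ℝ) :
    ∫ ξ : ℝ in Ioi 0, (Real.cos (z * ξ) : ℂ) * cauchyKernel μ ξ =
      Real.pi * (|z| * Complex.exp (-μ * |z|)) := by
  have h := integral_cexp_mul_cauchyKernel hμ z
  have hi : Integrable fun ξ : ℝ =>
      Complex.exp (Complex.I * (z * ξ : ℝ)) * cauchyKernel μ ξ := by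
    refine (integrable_cauchyKernel hμ).norm.mono'
      (.mul (by fun_prop) (integrable_cauchyKernel hμ).1) (ae_of_all _ fun t => ?_)
    rw [norm_mul, mul_comm Complex.I, Complex.norm_exp_ofReal_mul_I, one_mul]
  rw [integral_eq_integral_Ioi_add_comp_neg hi] at h
  have h2 : ∀ ξ : ℝ, Complex.exp (Complex.I * (z * ξ : ℝ)) * cauchyKernel μ ξ +
      Complex.exp (Complex.I * (z * -ξ : ℝ)) * cauchyKernel μ (-ξ) =
      2 * ((Real.cos (z * ξ) : ℂ) * cauchyKernel μ ξ) := fun ξ => by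
    rw [cauchyKernel_neg, Complex.ofReal_cos, Complex.cos]
    push_cast
    ring_nf
  simp only [h2] at h
  rw [integral_const_mul, mul_assoc (2 : ℂ)] at h
  exact mul_left_cancel₀ two_ne_zero h

lemma sq_add_sq_ne_zero {μ : ℂ} (hμ : 0 < μ.re) (ξ : ℝ) : (ξ : ℂ) ^ 2 + μ ^ 2 ≠ 0 := by
  have h := mul_ne_zero (add_I_mul_ne_zero hμ ξ) (add_I_mul_ne_zero hμ (-ξ))
  convert h using 1
  push_cast
  linear_combination (ξ : ℂ) ^ 2 * Complex.I_sq

lemma hasDerivAt_div_sq_add_sq {μ : ℂ} (hμ : 0 < μ.re) (ξ : ℝ) :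
    HasDerivAt (fun ξ : ℝ => (ξ : ℂ) / ((ξ : ℂ) ^ 2 + μ ^ 2)) (cauchyKernel μ ξ / 2) ξ := by
  have h1 : HasDerivAt (fun ξ : ℂ => ξ / (ξ ^ 2 + μ ^ 2))
      ((1 * ((ξ : ℂ) ^ 2 + μ ^ 2) - ξ * ((2 : ℕ) * (ξ : ℂ) ^ (2 - 1) * 1)) /
        ((ξ : ℂ) ^ 2 + μ ^ 2) ^ 2) ξ :=
    (hasDerivAt_id (ξ : ℂ)).div (((hasDerivAt_id (ξ : ℂ)).pow 2).add_const _)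
      (sq_add_sq_ne_zero hμ ξ)
  convert h1.comp_ofReal using 1
  have ha := add_I_mul_ne_zero hμ ξ
  have hb : μ - Complex.I * ξ ≠ 0 := by simpa [sub_eq_add_neg] using add_I_mul_ne_zero hμ (-ξ)
  have hab : (ξ : ℂ) ^ 2 + μ ^ 2 = (μ + Complex.I * ξ) * (μ - Complex.I * ξ) := by
    linear_combination (ξ : ℂ) ^ 2 * Complex.I_sq
  have hnum : 1 * ((ξ : ℂ) ^ 2 + μ ^ 2) - ξ * ((2 : ℕ) * (ξ : ℂ) ^ (2 - 1) * 1) =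
      ((μ + Complex.I * ξ) ^ 2 + (μ - Complex.I * ξ) ^ 2) / 2 := by
    push_cast
    linear_combination - (ξ : ℂ) ^ 2 * Complex.I_sq
  rw [hnum, hab, cauchyKernel]
  field_simp
  ring

lemma tendsto_div_sq_add_atTop (w : ℂ) :
    Tendsto (fun ξ : ℝ => (ξ : ℂ) / ((ξ : ℂ) ^ 2 + w)) atTop (𝓝 0) := by
  have h0 : Tendsto (fun ξ : ℝ => ((ξ⁻¹ : ℝ) : ℂ)) atTop (𝓝 ((0 : ℝ) : ℂ)) :=
    (Complex.continuous_ofReal.tendsto 0).comp tendsto_inv_atTop_zero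
  have h1 := h0.div (((h0.pow 2).const_mul w).const_add 1) (by simp)
  simp only [Complex.ofReal_zero, zero_div] at h1
  refine h1.congr' ?_
  filter_upwards [eventually_gt_atTop 0] with ξ hξ
  have : (ξ : ℂ) ≠ 0 := by exact_mod_cast hξ.ne'
  simp only [Pi.div_apply, Complex.ofReal_inv]
  rw [show (1 : ℂ) + w * (ξ : ℂ)⁻¹ ^ 2 = ((ξ : ℂ) ^ 2 + w) / (ξ : ℂ) ^ 2 by field_simp]
  rw [div_div_eq_mul_div]
  congr 1
  field_simp

lemma integrableOn_cos_mul_cauchyKernel {μ : ℂ} (hμ : 0 < μ.re) (z : ℝ) (s : Set ℝ) :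
    IntegrableOn (fun ξ : ℝ => (Real.cos (z * ξ) : ℂ) * cauchyKernel μ ξ) s := by
  have hk := integrable_cauchyKernel hμ
  refine (hk.norm.mono' (.mul (by fun_prop) hk.1) (ae_of_all _ fun t => ?_)).integrableOn
  rw [Pi.mul_apply, norm_mul, Complex.norm_real]
  exact mul_le_of_le_one_left (norm_nonneg _) (Real.abs_cos_le_one _)

lemma tendsto_integral_sin_mul_div_sq_add_sq {μ : ℂ} (hμ : 0 < μ.re) {z : ℝ} (hz : z ≠ 0) :
    Tendsto (fun R : ℝ => ∫ ξ in (0 : ℝ)..R,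
        (Real.sin (z * ξ) : ℂ) * ((ξ : ℂ) / ((ξ : ℂ) ^ 2 + μ ^ 2)))
      atTop (𝓝 (Real.pi / 2 * ((|z| / z : ℝ) * Complex.exp (-μ * |z|)))) := by
  have hzc : (z : ℂ) ≠ 0 := by exact_mod_cast hz
  have hv : ∀ ξ : ℝ, HasDerivAt (fun ξ : ℝ => ((-(Real.cos (z * ξ) / z) : ℝ) : ℂ))
      (Real.sin (z * ξ) : ℂ) ξ := fun ξ => by
    have h : HasDerivAt (fun ξ : ℝ => -(Real.cos (z * ξ) / z)) (Real.sin (z * ξ)) ξ := by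
      convert! (((hasDerivAt_id ξ).const_mul z).cos.div_const z).neg using 1
      simp
      field_simp
    exact h.ofReal_comp
  have hparts : ∀ R : ℝ, (∫ ξ in (0 : ℝ)..R,
        (Real.sin (z * ξ) : ℂ) * ((ξ : ℂ) / ((ξ : ℂ) ^ 2 + μ ^ 2))) =
      (R : ℂ) / ((R : ℂ) ^ 2 + μ ^ 2) * ((-(Real.cos (z * R) / z) : ℝ) : ℂ) +
        1 / (2 * z) * ∫ ξ in (0 : ℝ)..R, (Real.cos (z * ξ) : ℂ) * cauchyKernel μ ξ := fun R => by
    have h := intervalIntegral.integral_mul_deriv_eq_deriv_mul (a := 0) (b := R)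
      (fun ξ _ => hasDerivAt_div_sq_add_sq hμ ξ) (fun ξ _ => hv ξ)
      ((integrable_cauchyKernel hμ).div_const 2).intervalIntegrable
      (Continuous.intervalIntegrable (by fun_prop) _ _)
    simp only [mul_comm (Complex.ofReal (Real.sin _))]
    rw [h, ← intervalIntegral.integral_const_mul]
    simp only [Complex.ofReal_zero, zero_div, zero_mul, sub_zero]
    rw [sub_eq_add_neg, ← intervalIntegral.integral_neg]
    congr 2
    ext ξ
    push_cast
    field_simp
  simp only [hparts]
  have h1 : Tendsto (fun R : ℝ => (R : ℂ) / ((R : ℂ) ^ 2 + μ ^ 2) *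
      ((-(Real.cos (z * R) / z) : ℝ) : ℂ)) atTop (𝓝 0) := by
    refine (tendsto_div_sq_add_atTop (μ ^ 2)).zero_mul_isBoundedUnder_le
      (isBoundedUnder_of ⟨1 / |z|, fun R => ?_⟩)
    simp only [Function.comp_apply, Complex.norm_real, norm_neg, norm_div, Real.norm_eq_abs]
    gcongr
    exact Real.abs_cos_le_one _
  have h2 := intervalIntegral_tendsto_integral_Ioi 0
    (integrableOn_cos_mul_cauchyKernel hμ z (Ioi 0)) tendsto_id
  rw [integral_cos_mul_cauchyKernel hμ z] at h2
  have h3 := h1.add (h2.const_mul (1 / (2 * (z : ℂ))))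
  convert! h3 using 2
  push_cast
  field_simp
  ring

lemma exists_tendsto_integral_sinc :
    ∃ D : ℝ, Tendsto (fun R : ℝ => ∫ x in (0 : ℝ)..R, Real.sinc x) atTop (𝓝 D) := by
  have h1 := tendsto_integral_sin_mul_div_sq_add_sq (μ := 1) (by simp) one_ne_zero
  have hi : Integrable fun x : ℝ => Real.sinc x * (1 + x ^ 2)⁻¹ := by
    refine integrable_inv_one_add_sq.mono'
      (.mul Real.continuous_sinc.aestronglyMeasurable integrable_inv_one_add_sq.1)
      (ae_of_all _ fun x => ?_)
    rw [norm_mul, Real.norm_of_nonneg (by positivity : 0 ≤ (1 + x ^ 2)⁻¹)]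
    exact mul_le_of_le_one_left (by positivity) (Real.abs_sinc_le_one x)
  have h2 := intervalIntegral_tendsto_integral_Ioi 0 (hi.integrableOn (s := Ioi 0)) tendsto_id
  have h3 := ((Complex.continuous_re.tendsto _).comp h1).add h2
  refine ⟨_, h3.congr fun R => ?_⟩
  have hne : ∀ x : ℝ, 1 + x ^ 2 ≠ 0 := fun x => by positivity
  have hre : (∫ ξ in (0 : ℝ)..R,
      (Real.sin (1 * ξ) : ℂ) * ((ξ : ℂ) / ((ξ : ℂ) ^ 2 + 1 ^ 2))) =
      ((∫ ξ in (0 : ℝ)..R, Real.sin ξ * (ξ / (1 + ξ ^ 2)) : ℝ) : ℂ) := by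
    rw [← intervalIntegral.integral_ofReal]
    congr 1
    ext ξ
    push_cast
    simp [add_comm]
  simp only [Function.comp_apply, id]
  rw [hre, Complex.ofReal_re, ← intervalIntegral.integral_add
    (Continuous.intervalIntegrable (by fun_prop (disch := exact hne _)) _ _)
    hi.intervalIntegrable]
  congr 1
  ext x
  rcases eq_or_ne x 0 with rfl | hx
  · simp
  · have := hne x
    rw [Real.sinc_of_ne_zero hx]
    field_simp
    ring

lemma exists_tendsto_integral_sin_mul_div_sq :
    ∃ D : ℝ, ∀ z : ℝ, ∃ l : ℂ, ‖l‖ ≤ D ∧ Tendsto (fun R : ℝ => ∫ ξ in (0 : ℝ)..R,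
        (Real.sin (z * ξ) : ℂ) * ((ξ : ℂ) / (ξ : ℂ) ^ 2)) atTop (𝓝 l) := by
  obtain ⟨D, hD⟩ := exists_tendsto_integral_sinc
  have key : ∀ z R : ℝ, (∫ ξ in (0 : ℝ)..R, (Real.sin (z * ξ) : ℂ) * ((ξ : ℂ) / (ξ : ℂ) ^ 2)) =
      ((∫ x in (0 : ℝ)..z * R, Real.sinc x : ℝ) : ℂ) := fun z R => by
    have h := intervalIntegral.mul_integral_comp_mul_left (f := Real.sinc) (a := 0) (b := R)
      (c := z)
    rw [mul_zero] at h
    rw [← h, ← intervalIntegral.integral_const_mul, ← intervalIntegral.integral_ofReal]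
    refine intervalIntegral.integral_congr_ae ?_
    filter_upwards [compl_mem_ae_iff.2 (measure_singleton (0 : ℝ))] with x hx _
    have hx : x ≠ 0 := hx
    have hxc : (x : ℂ) ≠ 0 := by exact_mod_cast hx
    rcases eq_or_ne z 0 with rfl | hz
    · simp
    · have hzc : (z : ℂ) ≠ 0 := by exact_mod_cast hz
      rw [Real.sinc_of_ne_zero (mul_ne_zero hz hx)]
      push_cast
      field_simp
  have hneg : ∀ y : ℝ, (∫ x in (0 : ℝ)..-y, Real.sinc x) = -∫ x in (0 : ℝ)..y, Real.sinc x :=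
    fun y => by
    have h := intervalIntegral.integral_comp_neg (a := 0) (b := y) Real.sinc
    simp only [Real.sinc_neg, neg_zero] at h
    rw [h, intervalIntegral.integral_symm]
  refine ⟨|D|, fun z => ?_⟩
  simp only [key]
  rcases lt_trichotomy z 0 with hz | rfl | hz
  · refine ⟨((-D : ℝ) : ℂ), by simp, (Complex.continuous_ofReal.tendsto _).comp ?_⟩
    have h := (hD.comp (tendsto_id.const_mul_atTop (neg_pos.2 hz))).neg
    refine h.congr fun R => ?_
    simp [hneg]
  · exact ⟨0, by simp, by simp⟩
  · exact ⟨D, by simp, (Complex.continuous_ofReal.tendsto _).comp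
      (hD.comp (tendsto_id.const_mul_atTop hz))⟩

lemma exists_sq_eq_of_mem_slitPlane {w : ℂ} (hw : w ∈ Complex.slitPlane) :
    ∃ μ : ℂ, 0 < μ.re ∧ μ ^ 2 = w := by
  have h0 := Complex.slitPlane_ne_zero hw
  refine ⟨Complex.exp (Complex.log w / 2), ?_, ?_⟩
  · rw [Complex.exp_re]
    refine mul_pos (Real.exp_pos _) (Real.cos_pos_of_mem_Ioo ?_)
    have h1 := Complex.neg_pi_lt_arg w
    have h2 := (Complex.arg_le_pi w).lt_of_ne (Complex.mem_slitPlane_iff_arg.1 hw).1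
    have h3 : (Complex.log w / 2).im = w.arg / 2 := by
      rw [show (2 : ℂ) = ((2 : ℝ) : ℂ) by simp, Complex.div_ofReal_im, Complex.log_im]
    rw [h3]
    constructor <;> linarith
  · rw [← Complex.exp_nat_mul]
    push_cast
    rw [mul_div_cancel₀ _ two_ne_zero, Complex.exp_log h0]

lemma exists_tendsto_integral_sin_mul_div_sq_add :
    ∃ D : ℝ, ∀ w : ℂ, w = 0 ∨ w ∈ Complex.slitPlane → ∀ z : ℝ, ∃ l : ℂ, ‖l‖ ≤ D ∧
      Tendsto (fun R : ℝ => ∫ ξ in (0 : ℝ)..R,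
        (Real.sin (z * ξ) : ℂ) * ((ξ : ℂ) / ((ξ : ℂ) ^ 2 + w))) atTop (𝓝 l) := by
  obtain ⟨D, hD⟩ := exists_tendsto_integral_sin_mul_div_sq
  refine ⟨max D (Real.pi / 2), fun w hw z => ?_⟩
  rcases hw with rfl | hw
  · obtain ⟨l, hl, ht⟩ := hD z
    exact ⟨l, hl.trans (le_max_left _ _), by simpa using ht⟩
  · obtain ⟨μ, hμ, rfl⟩ := exists_sq_eq_of_mem_slitPlane hw
    rcases eq_or_ne z 0 with rfl | hz
    · exact ⟨0, by simpa using Or.inr (by positivity), by simp⟩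
    refine ⟨_, le_trans ?_ (le_max_right _ _), tendsto_integral_sin_mul_div_sq_add_sq hμ hz⟩
    have h1 : ‖Complex.exp (-μ * |z|)‖ ≤ 1 := by
      rw [Complex.norm_exp, Real.exp_le_one_iff]
      simp only [neg_mul, Complex.neg_re, Complex.re_mul_ofReal, Left.neg_nonpos_iff]
      positivity
    rw [norm_mul, norm_mul, Complex.norm_real, norm_div, norm_div, Complex.norm_real,
      Real.norm_eq_abs |z|, abs_abs, Real.norm_eq_abs z, div_self (abs_ne_zero.2 hz), one_mul,
      Real.norm_of_nonneg Real.pi_pos.le, Complex.norm_ofNat]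
    exact mul_le_of_le_one_right (by positivity) h1

lemma intervalIntegrable_sin_mul_div_sq_add {w : ℂ} (hw : w = 0 ∨ w ∈ Complex.slitPlane)
    (z a b : ℝ) : IntervalIntegrable (fun ξ : ℝ =>
      (Real.sin (z * ξ) : ℂ) * ((ξ : ℂ) / ((ξ : ℂ) ^ 2 + w))) volume a b := by
  rcases hw with rfl | hw
  · have h : IntervalIntegrable (fun ξ : ℝ => ((z * Real.sinc (z * ξ) : ℝ) : ℂ)) volume a b :=
      Continuous.intervalIntegrable (Complex.continuous_ofReal.comp
        (continuous_const.mul (Real.continuous_sinc.comp (continuous_const_mul z)))) _ _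
    refine h.congr_ae (ae_restrict_of_ae ?_)
    filter_upwards [compl_mem_ae_iff.2 (measure_singleton (0 : ℝ))] with x hx
    have hx : x ≠ 0 := hx
    have hxc : (x : ℂ) ≠ 0 := by exact_mod_cast hx
    rcases eq_or_ne z 0 with rfl | hz
    · simp
    · have hzc : (z : ℂ) ≠ 0 := by exact_mod_cast hz
      rw [Real.sinc_of_ne_zero (mul_ne_zero hz hx)]
      push_cast
      rw [add_zero]
      field_simp
  · obtain ⟨μ, hμ, rfl⟩ := exists_sq_eq_of_mem_slitPlane hw
    have hne := sq_add_sq_ne_zero hμ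
    exact Continuous.intervalIntegrable (by fun_prop (disch := exact hne _)) _ _

lemma setIntegral_le_abs_le {F : ℝ → ℂ} (hF : ContinuousOn F {0}ᶜ) {ε R : ℝ} (hε : 0 < ε)
    (hR : ε ≤ R) :
    ∫ ξ in {ξ : ℝ | ε ≤ |ξ| ∧ |ξ| ≤ R}, F ξ = ∫ ξ in ε..R, (F ξ + F (-ξ)) := by
  have hset : {ξ : ℝ | ε ≤ |ξ| ∧ |ξ| ≤ R} = Icc ε R ∪ Icc (-R) (-ε) := by
    ext ξ
    simp only [mem_ofPred_eq, mem_union, mem_Icc]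
    rcases abs_cases ξ with ⟨h, h'⟩ | ⟨h, h'⟩ <;> rw [h] <;> constructor
    · exact Or.inl
    · rintro (h | h)
      · exact h
      · constructor <;> linarith
    · exact fun h => Or.inr (by constructor <;> linarith)
    · rintro (h | h) <;> constructor <;> linarith
  have hdisj : Disjoint (Icc ε R) (Icc (-R) (-ε)) :=
    disjoint_left.2 fun ξ h1 h2 => by linarith [h1.1, h2.2]
  have hpos : ContinuousOn F (Icc ε R) :=
    hF.mono fun ξ h => (hε.trans_le h.1).ne'
  have hneg : ContinuousOn F (Icc (-R) (-ε)) :=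
    hF.mono fun ξ h => (h.2.trans_lt (neg_neg_of_pos hε)).ne
  have hneg' : ContinuousOn (fun ξ => F (-ξ)) (Icc ε R) :=
    hneg.comp continuousOn_neg fun ξ h => ⟨neg_le_neg h.2, neg_le_neg h.1⟩
  rw [hset, setIntegral_union hdisj measurableSet_Icc hpos.integrableOn_Icc hneg.integrableOn_Icc,
    integral_Icc_eq_integral_Ioc, integral_Icc_eq_integral_Ioc,
    ← intervalIntegral.integral_of_le hR, ← intervalIntegral.integral_of_le (neg_le_neg hR),
    ← intervalIntegral.integral_comp_neg, ← intervalIntegral.integral_add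
      (hpos.intervalIntegrable_of_Icc hR) (hneg'.intervalIntegrable_of_Icc hR)]

lemma div_one_sub_I_mul_eq_zero_or_mem_slitPlane {ν s : ℝ} (hν : 0 < ν) (hs : 0 ≤ s) (τ : ℝ) :
    ((τ : ℂ) - Complex.I * ν * s) / (1 - Complex.I * ν) = 0 ∨
      ((τ : ℂ) - Complex.I * ν * s) / (1 - Complex.I * ν) ∈ Complex.slitPlane := by
  have ha : (1 - Complex.I * ν : ℂ) ≠ 0 := fun h => by
    have := congrArg Complex.re h
    simp at this
  obtain ⟨w, hw⟩ : ∃ w, w = ((τ : ℂ) - Complex.I * ν * s) / (1 - Complex.I * ν) := ⟨_, rfl⟩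
  rw [← hw]
  rw [eq_div_iff ha] at hw
  by_cases hm : w ∈ Complex.slitPlane
  · exact Or.inr hm
  rw [Complex.mem_slitPlane_iff, not_or, not_lt, not_not] at hm
  have him := congrArg Complex.im hw
  simp [hm.2] at him
  refine Or.inl (Complex.ext (le_antisymm hm.1 ?_) hm.2)
  have : w.re = s := mul_right_cancel₀ hν.ne' (by linarith)
  simpa [this] using hs

/-- the principal-value integral
`K(τ,z) = lim_{R→∞} lim_{ε→0⁺} ∫_{ε ≤ |ξ| ≤ R} e^{izξ} ξ / (τ + ξ² - iν(ξ² + s)) dξ`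
exists and is bounded by an absolute constant `C`, uniformly in `ν > 0`, `s ≥ 0`,
`τ, z ∈ ℝ`. -/
theorem stmt_1 :
    ∃ C : ℝ, 0 < C ∧
      ∀ (ν : ℝ), 0 < ν → ∀ (s : ℝ), 0 ≤ s → ∀ (τ z : ℝ),
        ∃ (K : ℂ) (L : ℝ → ℂ),
          (∀ R : ℝ,
            Filter.Tendsto
              (fun ε : ℝ =>
                ∫ ξ in {ξ : ℝ | ε ≤ |ξ| ∧ |ξ| ≤ R},
                  e (z * ξ) * (ξ : ℂ) /
                    ((τ : ℂ) + (ξ : ℂ) ^ 2 - Complex.I * (ν : ℂ) * ((ξ : ℂ) ^ 2 + (s : ℂ))))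
              (nhdsWithin 0 (Set.Ioi 0)) (nhds (L R))) ∧
          Filter.Tendsto L Filter.atTop (nhds K) ∧ ‖K‖ ≤ C := by
  obtain ⟨D, hD⟩ := exists_tendsto_integral_sin_mul_div_sq_add
  refine ⟨2 * |D| + 1, by positivity, fun ν hν s hs τ z => ?_⟩
  have hw := div_one_sub_I_mul_eq_zero_or_mem_slitPlane hν hs τ
  have hre : (1 - Complex.I * ν : ℂ).re = 1 := by simp
  have ha : (1 - Complex.I * ν : ℂ) ≠ 0 := fun h => by simp [h] at hre
  have ha1 : 1 ≤ ‖(1 - Complex.I * ν : ℂ)‖ := by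
    simpa [hre] using Complex.abs_re_le_norm (1 - Complex.I * ν : ℂ)
  have hden : ∀ ξ : ℝ, (τ : ℂ) + (ξ : ℂ) ^ 2 - Complex.I * (ν : ℂ) * ((ξ : ℂ) ^ 2 + (s : ℂ)) =
      (1 - Complex.I * ν) *
        ((ξ : ℂ) ^ 2 + ((τ : ℂ) - Complex.I * ν * s) / (1 - Complex.I * ν)) := fun ξ => by
    rw [mul_add (1 - Complex.I * (ν : ℂ)), mul_div_cancel₀ _ ha]
    ring
  have hden0 : ∀ ξ ∈ ({0}ᶜ : Set ℝ),
      (τ : ℂ) + (ξ : ℂ) ^ 2 - Complex.I * (ν : ℂ) * ((ξ : ℂ) ^ 2 + (s : ℂ)) ≠ 0 := fun ξ hξ h => by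
    have him := congrArg Complex.im h
    have hξ : ξ ≠ 0 := hξ
    simp [← Complex.ofReal_pow] at him
    have : 0 < ξ ^ 2 + s := by positivity
    rcases him with h | h
    · exact hν.ne' h
    · exact this.ne' h
  have hcont : ContinuousOn (fun ξ : ℝ => e (z * ξ) * (ξ : ℂ) /
      ((τ : ℂ) + (ξ : ℂ) ^ 2 - Complex.I * (ν : ℂ) * ((ξ : ℂ) ^ 2 + (s : ℂ)))) {0}ᶜ := by
    unfold e
    exact ContinuousOn.div (by fun_prop) (by fun_prop) hden0
  have hsum : ∀ ξ : ℝ, e (z * ξ) * (ξ : ℂ) /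
      ((τ : ℂ) + (ξ : ℂ) ^ 2 - Complex.I * (ν : ℂ) * ((ξ : ℂ) ^ 2 + (s : ℂ))) +
      e (z * -ξ) * ((-ξ : ℝ) : ℂ) /
      ((τ : ℂ) + ((-ξ : ℝ) : ℂ) ^ 2 - Complex.I * (ν : ℂ) * (((-ξ : ℝ) : ℂ) ^ 2 + (s : ℂ))) =
      2 * Complex.I / (1 - Complex.I * ν) * ((Real.sin (z * ξ) : ℂ) *
        ((ξ : ℂ) / ((ξ : ℂ) ^ 2 + ((τ : ℂ) - Complex.I * ν * s) / (1 - Complex.I * ν)))) :=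
    fun ξ => by
    have hexp : e (z * ξ) - e (z * -ξ) = 2 * Complex.I * Real.sin (z * ξ) := by
      simp only [e]
      rw [Complex.ofReal_sin, Complex.sin]
      push_cast
      rw [show Complex.I * (z * -ξ) = -(z * ξ) * Complex.I by ring, mul_comm Complex.I (z * ξ : ℂ)]
      linear_combination (Complex.exp (z * ξ * Complex.I) - Complex.exp (-(z * ξ) * Complex.I)) *
        Complex.I_sq
    rw [Complex.ofReal_neg, neg_sq, ← add_div, hden ξ, mul_neg, ← sub_eq_add_neg, ← sub_mul, hexp]
    simp only [div_eq_mul_inv, mul_inv]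
    ring
  obtain ⟨l, hl, hlim⟩ := hD _ hw z
  have hint := intervalIntegrable_sin_mul_div_sq_add hw z
  generalize ((τ : ℂ) - Complex.I * ν * s) / (1 - Complex.I * ν) = w at *
  refine ⟨2 * Complex.I / (1 - Complex.I * ν) * l, fun R => if R ≤ 0 then 0 else
    2 * Complex.I / (1 - Complex.I * ν) * ∫ ξ in (0 : ℝ)..R,
      (Real.sin (z * ξ) : ℂ) * ((ξ : ℂ) / ((ξ : ℂ) ^ 2 + w)), fun R => ?_, ?_, ?_⟩
  · rcases le_or_gt R 0 with hR | hR
    · simp only [hR, if_true]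
      refine tendsto_const_nhds.congr' ?_
      filter_upwards [self_mem_nhdsWithin] with ε hε
      have : {ξ : ℝ | ε ≤ |ξ| ∧ |ξ| ≤ R} = ∅ :=
        eq_empty_of_forall_notMem fun ξ h => by linarith [h.1, h.2, mem_Ioi.1 hε]
      rw [this, setIntegral_empty]
    · simp only [hR.not_ge, if_false]
      have h1 : Tendsto (fun ε : ℝ => ∫ ξ in ε..R,
          (Real.sin (z * ξ) : ℂ) * ((ξ : ℂ) / ((ξ : ℂ) ^ 2 + w))) (𝓝[>] 0)
          (𝓝 (∫ ξ in (0 : ℝ)..R,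
            (Real.sin (z * ξ) : ℂ) * ((ξ : ℂ) / ((ξ : ℂ) ^ 2 + w)))) := by
        have h2 := (intervalIntegral.continuous_primitive hint R).neg.tendsto 0
        simp only [Pi.neg_apply, ← intervalIntegral.integral_symm] at h2
        exact (h2.mono_left nhdsWithin_le_nhds).congr fun ε =>
          (intervalIntegral.integral_symm R ε).symm
      refine (h1.const_mul _).congr' ?_
      filter_upwards [Ioc_mem_nhdsGT hR] with ε hε
      rw [setIntegral_le_abs_le hcont hε.1 hε.2]
      simp only [hsum]
      rw [intervalIntegral.integral_const_mul]
  · refine (hlim.const_mul _).congr' ?_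
    filter_upwards [eventually_gt_atTop 0] with R hR
    simp only [hR.not_ge, if_false]
  · rw [norm_mul, norm_div, norm_mul, Complex.norm_I, Complex.norm_ofNat, mul_one]
    have h2 : 2 / ‖(1 - Complex.I * ν : ℂ)‖ ≤ 2 := div_le_self zero_le_two ha1
    calc _ ≤ 2 * |D| := mul_le_mul h2 (hl.trans (le_abs_self D)) (norm_nonneg _) zero_le_two
      _ ≤ _ := by linarith
end
end

section
/- There is a constant C such that for every ν > 0, every s ≥ 0, and every Schwartz function f on ℝ² = ℝ_t × ℝ_x, the function u = 𝓕⁻¹_{τ,ξ}[ ξ/(ξ² - iν(ξ² + s) + τ) · (𝓕_{t,x} f)(τ,ξ) ] satisfies ess sup_{x∈ℝ} ( ∫_ℝ |u(t,x)|² dt )^{1/2} ≤ C ∫_ℝ ( ∫_ℝ |f(t,x)|² dt )^{1/2} dx. -/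
open MeasureTheory

noncomputable section

/-- The Fourier transform `𝓕_{t,x} f` of `f` in both variables `(t,x) ↦ (τ,ξ)`. -/
def FT2 (f : ℝ × ℝ → ℂ) (τ ξ : ℝ) : ℂ :=
  ∫ p : ℝ × ℝ, e (-(p.1 * τ + p.2 * ξ)) * f p

/-- `u = 𝓕⁻¹_{τ,ξ}[ ξ/(ξ² - iν(ξ² + s) + τ) · 𝓕_{t,x} f ]`, written as an absolutely
convergent inverse Fourier integral. -/
def uMul (ν s : ℝ) (f : ℝ × ℝ → ℂ) (t x : ℝ) : ℂ :=
  ((2 * Real.pi) ^ 2)⁻¹ •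
    ∫ q : ℝ × ℝ,
      e (t * q.1 + x * q.2) *
        ((q.2 : ℂ) /
          ((q.2 : ℂ) ^ 2 - Complex.I * (ν : ℂ) * ((q.2 : ℂ) ^ 2 + (s : ℂ)) + (q.1 : ℂ))) *
        FT2 f q.1 q.2

open scoped FourierTransform ENNReal

lemma norm_e (r : ℝ) : ‖e r‖ = 1 := by
  rw [e, mul_comm]
  exact Complex.norm_exp_ofReal_mul_I r

@[fun_prop]
lemma continuous_e : Continuous e := by
  unfold e
  fun_prop

lemma e_add (a b : ℝ) : e (a + b) = e a * e b := by
  simp [e, mul_add, Complex.exp_add]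

lemma integrable_e_mul {α : Type*} [MeasurableSpace α] {μ : Measure α} {g : α → ℂ} {φ : α → ℝ}
    (hφ : Measurable φ) (hg : Integrable g μ) : Integrable (fun a => e (φ a) * g a) μ :=
  hg.bdd_mul (c := 1) (continuous_e.measurable.comp hφ).aestronglyMeasurable
    (Filter.Eventually.of_forall fun _ => (norm_e _).le)

lemma continuous_integral_e_mul {g : ℝ → ℂ} (hg : Integrable g) :
    Continuous fun τ : ℝ => ∫ t : ℝ, e (-(t * τ)) * g t := by
  refine continuous_of_dominated (bound := fun t => ‖g t‖) (fun τ => ?_) (fun τ => ?_) hg.norm ?_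
  · exact (integrable_e_mul (by fun_prop) hg).aestronglyMeasurable
  · exact Filter.Eventually.of_forall fun t => by simp [norm_e]
  · exact Filter.Eventually.of_forall fun t => by fun_prop

/-- The one-dimensional Fourier transform without `2π` in the exponent is a rescaling of `𝓕`. -/
lemma integral_e_mul_eq_fourier (g : ℝ → ℂ) (τ : ℝ) :
    ∫ t : ℝ, e (-(t * τ)) * g t = 𝓕 g ((2 * Real.pi)⁻¹ * τ) := by
  rw [Real.fourier_eq']
  refine integral_congr_ae (Filter.Eventually.of_forall fun t => ?_)
  have hπ : (Real.pi : ℂ) ≠ 0 := by exact_mod_cast Real.pi_ne_zero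
  simp only [e, smul_eq_mul, RCLike.inner_apply, conj_trivial]
  congr 2
  push_cast
  field_simp

lemma lintegral_comp_mul_left_real (φ : ℝ → ℝ≥0∞) {a : ℝ} (ha : a ≠ 0) :
    ∫⁻ x, φ (a * x) = ENNReal.ofReal |a⁻¹| * ∫⁻ x, φ x := by
  have h := lintegral_map_equiv (μ := volume) φ (Homeomorph.mulLeft₀ a ha).toMeasurableEquiv
  have hm : Measure.map (fun x => a * x) volume = ENNReal.ofReal |a⁻¹| • (volume : Measure ℝ) :=
    Real.map_volume_mul_left ha
  simp only [Homeomorph.toMeasurableEquiv_coe, Homeomorph.coe_mulLeft₀] at h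
  rw [← h, hm, lintegral_smul_measure, smul_eq_mul]

/-- On `L¹ ∩ L²` the Fourier integral agrees almost everywhere with the `L²` Fourier transform. -/
lemma fourier_toLp_ae_eq {g : ℝ → ℂ} (hg : Integrable g) (hg2 : MemLp g 2) :
    ∀ᵐ τ, (𝓕 (hg2.toLp g) : Lp (α := ℝ) ℂ 2) τ = 𝓕 g τ := by
  have hcont : Continuous (𝓕 g) := by
    have h := (continuous_integral_e_mul hg).comp (continuous_const_mul (2 * Real.pi))
    refine h.congr fun τ => ?_
    simp only [Function.comp, integral_e_mul_eq_fourier]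
    rw [inv_mul_cancel_left₀ (by positivity)]
  refine ae_eq_of_integral_contDiff_smul_eq
    ((Lp.memLp _).locallyIntegrable (by norm_num)) hcont.locallyIntegrable fun φ hφ hφc => ?_
  have hψc : HasCompactSupport fun x => (φ x : ℂ) := hφc.comp_left Complex.ofReal_zero
  have hψ : ContDiff ℝ (⊤ : ℕ∞) fun x => (φ x : ℂ) := Complex.ofRealCLM.contDiff.comp hφ
  let ψ : SchwartzMap ℝ ℂ := hψc.toSchwartzMap hψ
  have hT := congrArg (fun T : TemperedDistribution ℝ ℂ => T ψ)
    (Lp.fourier_toTemperedDistribution_eq (hg2.toLp g))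
  simp only [TemperedDistribution.fourier_apply, Lp.toTemperedDistribution_apply] at hT
  have hswap : ∫ x, (𝓕 ψ) x • g x = ∫ x, ψ x • 𝓕 g x := by
    simpa using! VectorFourier.integral_fourierIntegral_smul_eq_flip (L := innerₗ ℝ)
      Real.continuous_fourierChar continuous_inner ψ.integrable hg
  have hcongr : ∫ x, (𝓕 ψ) x • (hg2.toLp g) x = ∫ x, (𝓕 ψ) x • g x :=
    integral_congr_ae (hg2.coeFn_toLp.mono fun x hx => by simp only [hx])
  rw [hcongr, hswap] at hT
  simpa [ψ] using hT.symm

/-- Plancherel's inequality for integrable functions. -/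
lemma lintegral_integral_e_mul_sq_le {g : ℝ → ℂ} (hg : Integrable g) :
    ∫⁻ τ : ℝ, ‖∫ t : ℝ, e (-(t * τ)) * g t‖ₑ ^ 2
      ≤ ENNReal.ofReal (2 * Real.pi) * ∫⁻ t, ‖g t‖ₑ ^ 2 := by
  have hpi := Real.pi_pos
  simp only [integral_e_mul_eq_fourier]
  rw [lintegral_comp_mul_left_real (fun τ => ‖𝓕 g τ‖ₑ ^ 2) (by positivity), inv_inv,
    abs_of_pos (by positivity)]
  gcongr _ * ?_
  by_cases htop : ∫⁻ t, ‖g t‖ₑ ^ 2 = ∞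
  · simp [htop]
  have key : ∀ h : ℝ → ℂ, ∫⁻ t, ‖h t‖ₑ ^ 2 = eLpNorm h 2 volume ^ 2 := fun h => by
    rw [eLpNorm_eq_lintegral_rpow_enorm_toReal (by norm_num) (by norm_num), ← ENNReal.rpow_natCast,
      ← ENNReal.rpow_mul]
    simp
  have hg2 : MemLp g 2 := by
    refine ⟨hg.aestronglyMeasurable, ?_⟩
    rw [key] at htop
    exact lt_top_iff_ne_top.2 fun h => htop (by simp [h])
  rw [key, key, ← eLpNorm_congr_ae (fourier_toLp_ae_eq hg hg2), ← eLpNorm_congr_ae hg2.coeFn_toLp,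
    ← Lp.enorm_def, ← Lp.enorm_def]
  simp only [← ofReal_norm, Lp.norm_fourier_eq]
  exact le_rfl

/-- Minkowski's integral inequality in `L²`. -/
lemma lintegral_lintegral_sq_le {H : ℝ × ℝ → ℝ≥0∞} (hH : Measurable H) :
    ∫⁻ τ, (∫⁻ y, H (τ, y)) ^ 2 ≤ (∫⁻ y, (∫⁻ τ, H (τ, y) ^ 2) ^ (1 / 2 : ℝ)) ^ 2 := by
  set N : ℝ → ℝ≥0∞ := fun y => (∫⁻ τ, H (τ, y) ^ 2) ^ (1 / 2 : ℝ) with hN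
  have hNm : Measurable N := by
    refine Measurable.pow_const ?_ _
    exact (hH.pow_const 2).lintegral_prod_left'
  calc ∫⁻ τ, (∫⁻ y, H (τ, y)) ^ 2
      = ∫⁻ τ, ∫⁻ y, ∫⁻ y', H (τ, y) * H (τ, y') := by
        refine lintegral_congr fun τ => ?_
        rw [sq, ← lintegral_mul_const _ (by fun_prop)]
        refine lintegral_congr fun y => ?_
        rw [lintegral_const_mul _ (by fun_prop)]
    _ = ∫⁻ y, ∫⁻ τ, ∫⁻ y', H (τ, y) * H (τ, y') := by
        refine lintegral_lintegral_swap (Measurable.aemeasurable ?_)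
        refine Measurable.lintegral_prod_right' (f := fun p : (ℝ × ℝ) × ℝ =>
          H (p.1.1, p.1.2) * H (p.1.1, p.2)) (by fun_prop)
    _ = ∫⁻ y, ∫⁻ y', ∫⁻ τ, H (τ, y) * H (τ, y') := by
        refine lintegral_congr fun y => ?_
        exact lintegral_lintegral_swap (Measurable.aemeasurable (by fun_prop))
    _ ≤ ∫⁻ y, ∫⁻ y', N y * N y' := by
        refine lintegral_mono fun y => lintegral_mono fun y' => ?_
        have h := ENNReal.lintegral_mul_le_Lp_mul_Lq volume Real.HolderConjugate.two_two
          (f := fun τ => H (τ, y)) (g := fun τ => H (τ, y')) (by fun_prop) (by fun_prop)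
        simpa [hN] using h
    _ = (∫⁻ y, N y) ^ 2 := by
        rw [sq, ← lintegral_mul_const _ hNm]
        exact lintegral_congr fun y => lintegral_const_mul _ hNm

/-- Fourier inversion on the line, without `2π` in the exponents. -/
lemma integral_e_mul_integral_e_mul {h : ℝ → ℂ} (hc : Continuous h) (hi : Integrable h)
    (hF : Integrable fun ξ : ℝ => ∫ y : ℝ, e (-(y * ξ)) * h y) (x : ℝ) :
    ∫ ξ : ℝ, e (x * ξ) * ∫ y : ℝ, e (-(y * ξ)) * h y = (2 * Real.pi : ℝ) • h x := by
  have hpi := Real.pi_pos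
  have hne : (Real.pi : ℂ) ≠ 0 := by exact_mod_cast Real.pi_ne_zero
  simp only [integral_e_mul_eq_fourier] at hF ⊢
  have hF' : Integrable (𝓕 h) := by
    have := hF.comp_mul_left' (R := 2 * Real.pi) (by positivity)
    simpa only [inv_mul_cancel_left₀ (show (2 * Real.pi) ≠ 0 by positivity)] using this
  have hinv := congrFun (hc.fourierInv_fourier_eq hi hF') x
  rw [Real.fourierInv_eq'] at hinv
  have hscale := Measure.integral_comp_mul_left
    (fun ξ : ℝ => Complex.exp ((2 * Real.pi * inner ℝ ξ x : ℝ) * Complex.I) • 𝓕 h ξ)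
    ((2 * Real.pi)⁻¹)
  rw [hinv, inv_inv, abs_of_pos (by positivity)] at hscale
  rw [← hscale]
  refine integral_congr_ae (Filter.Eventually.of_forall fun ξ => ?_)
  simp only [e, smul_eq_mul, RCLike.inner_apply, conj_trivial]
  congr 2
  push_cast
  field_simp

/-- Integrating `k̂ ĥ` against an exponential costs at most `2π ‖k‖_∞ ‖h‖₁`. -/
lemma norm_integral_e_mul_fourier_mul_le {k h : ℝ → ℂ} {B : ℝ} (hk : Integrable k)
    (hB : ∀ y, ‖k y‖ ≤ B) (hc : Continuous h) (hi : Integrable h)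
    (hF : Integrable fun ξ : ℝ => ∫ y : ℝ, e (-(y * ξ)) * h y) (x : ℝ) :
    ‖∫ ξ : ℝ, e (x * ξ) * (∫ y : ℝ, e (-(y * ξ)) * k y) * ∫ y : ℝ, e (-(y * ξ)) * h y‖
      ≤ 2 * Real.pi * B * ∫ y, ‖h y‖ := by
  have hpi := Real.pi_pos
  set F : ℝ → ℂ := fun ξ => ∫ y : ℝ, e (-(y * ξ)) * h y with hFdef
  have hswap : ∫ ξ : ℝ, e (x * ξ) * (∫ y : ℝ, e (-(y * ξ)) * k y) * F ξ
      = ∫ y : ℝ, k y * ((2 * Real.pi : ℝ) • h (x - y)) := by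
    calc ∫ ξ : ℝ, e (x * ξ) * (∫ y : ℝ, e (-(y * ξ)) * k y) * F ξ
        = ∫ ξ : ℝ, ∫ y : ℝ, e (x * ξ + -(y * ξ)) * (F ξ * k y) := by
          refine integral_congr_ae (Filter.Eventually.of_forall fun ξ => ?_)
          simp only [e_add]
          rw [mul_right_comm, ← integral_const_mul]
          refine integral_congr_ae (Filter.Eventually.of_forall fun y => ?_)
          simp only
          ring
      _ = ∫ y : ℝ, ∫ ξ : ℝ, e (x * ξ + -(y * ξ)) * (F ξ * k y) :=
          integral_integral_swap (integrable_e_mul (by fun_prop) (hF.mul_prod hk))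
      _ = _ := by
          refine integral_congr_ae (Filter.Eventually.of_forall fun y => ?_)
          simp only
          rw [← integral_e_mul_integral_e_mul hc hi hF, ← integral_const_mul]
          refine integral_congr_ae (Filter.Eventually.of_forall fun ξ => ?_)
          simp only [hFdef]
          rw [show x * ξ + -(y * ξ) = (x - y) * ξ by ring]
          ring
  rw [hswap]
  have hi' : Integrable fun y => h (x - y) := hi.comp_sub_left x
  calc ‖∫ y : ℝ, k y * ((2 * Real.pi : ℝ) • h (x - y))‖
      ≤ ∫ y : ℝ, 2 * Real.pi * B * ‖h (x - y)‖ := by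
        refine norm_integral_le_of_norm_le (hi'.norm.const_mul _)
          (Filter.Eventually.of_forall fun y => ?_)
        rw [norm_mul, norm_smul, Real.norm_of_nonneg (by positivity)]
        have := mul_le_mul_of_nonneg_right (hB y)
          (show 0 ≤ 2 * Real.pi * ‖h (x - y)‖ by positivity)
        linarith
    _ = _ := by rw [integral_const_mul, integral_sub_left_eq_self (fun y => ‖h y‖)]

/-- For `Re z > 0`, the odd exponential kernel with Fourier transform `ξ / (a (ξ² + z²))`. -/
def oddExpKernel (a z : ℂ) (y : ℝ) : ℂ :=
  Complex.I / (2 * a) * if 0 < y then Complex.exp (-z * y) else -Complex.exp (z * y)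

lemma norm_oddExpKernel_le {a z : ℂ} (ha : 1 ≤ ‖a‖) (hz : 0 < z.re) (y : ℝ) :
    ‖oddExpKernel a z y‖ ≤ 1 / 2 := by
  have h1 : ‖Complex.I / (2 * a)‖ ≤ 1 / 2 := by
    rw [norm_div, Complex.norm_I, norm_mul, Complex.norm_ofNat]
    exact one_div_le_one_div_of_le (by norm_num) (by linarith)
  have h2 : ‖if 0 < y then Complex.exp (-z * y) else -Complex.exp (z * y)‖ ≤ 1 := by
    split_ifs with hy
    · rw [Complex.norm_exp, Real.exp_le_one_iff]
      simp only [Complex.mul_re, Complex.neg_re, Complex.ofReal_re, Complex.ofReal_im, mul_zero]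
      nlinarith
    · rw [norm_neg, Complex.norm_exp, Real.exp_le_one_iff]
      simp only [Complex.mul_re, Complex.ofReal_re, Complex.ofReal_im, mul_zero]
      nlinarith
  rw [oddExpKernel, norm_mul]
  calc _ ≤ 1 / 2 * (1 : ℝ) := mul_le_mul h1 h2 (norm_nonneg _) (by norm_num)
    _ = 1 / 2 := mul_one _

lemma integrable_oddExpKernel (a : ℂ) {z : ℂ} (hz : 0 < z.re) :
    Integrable (oddExpKernel a z) := by
  refine Integrable.const_mul ?_ _
  rw [← integrableOn_univ, ← Set.Iic_union_Ioi (a := (0 : ℝ))]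
  refine IntegrableOn.union ?_ ?_
  · refine (integrableOn_exp_mul_complex_Iic hz 0).neg.congr_fun (fun y hy => ?_) measurableSet_Iic
    simp [not_lt.2 (Set.mem_Iic.1 hy)]
  · refine (integrableOn_exp_mul_complex_Ioi (a := -z) (by simpa using hz) 0).congr_fun
      (fun y hy => ?_) measurableSet_Ioi
    simp [Set.mem_Ioi.1 hy]

lemma integral_e_mul_oddExpKernel {a z : ℂ} (ha : a ≠ 0) (hz : 0 < z.re) (ξ : ℝ) :
    ∫ y : ℝ, e (-(y * ξ)) * oddExpKernel a z y = ξ / (a * (ξ ^ 2 + z ^ 2)) := by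
  have hint : Integrable fun y : ℝ => e (-(y * ξ)) * oddExpKernel a z y :=
    integrable_e_mul (by fun_prop) (integrable_oddExpKernel a hz)
  have hp : z + Complex.I * ξ ≠ 0 := fun h => by
    have := congrArg Complex.re h
    simp at this
    linarith
  have hm : z - Complex.I * ξ ≠ 0 := fun h => by
    have := congrArg Complex.re h
    simp at this
    linarith
  have hIic : ∫ y in Set.Iic (0 : ℝ), e (-(y * ξ)) * oddExpKernel a z y
      = Complex.I / (2 * a) * -(1 / (z - Complex.I * ξ)) := by
    have h := integral_exp_mul_complex_Iic (a := z - Complex.I * ξ) (by simpa using hz) 0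
    rw [Complex.ofReal_zero, mul_zero, Complex.exp_zero] at h
    rw [← h, ← integral_neg, ← integral_const_mul]
    refine setIntegral_congr_fun measurableSet_Iic fun y hy => ?_
    simp only [oddExpKernel, e, not_lt.2 (Set.mem_Iic.1 hy), if_false]
    rw [mul_left_comm, mul_neg, ← Complex.exp_add]
    push_cast
    ring_nf
  have hIoi : ∫ y in Set.Ioi (0 : ℝ), e (-(y * ξ)) * oddExpKernel a z y
      = Complex.I / (2 * a) * (1 / (z + Complex.I * ξ)) := by
    have h := integral_exp_mul_complex_Ioi (a := -(z + Complex.I * ξ)) (by simpa using hz) 0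
    rw [Complex.ofReal_zero, mul_zero, Complex.exp_zero, neg_div_neg_eq] at h
    rw [← h, ← integral_const_mul]
    refine setIntegral_congr_fun measurableSet_Ioi fun y hy => ?_
    simp only [oddExpKernel, e, Set.mem_Ioi.1 hy, if_true]
    rw [mul_left_comm, ← Complex.exp_add]
    push_cast
    ring_nf
  rw [← intervalIntegral.integral_Iic_add_Ioi hint.integrableOn hint.integrableOn, hIic, hIoi]
  have hfac : (ξ : ℂ) ^ 2 + z ^ 2 = (z + Complex.I * ξ) * (z - Complex.I * ξ) := by
    ring_nf
    simp
  rw [hfac]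
  field_simp
  ring_nf
  simp

/-- For `τ ≠ 0` the multiplier is, in `ξ`, the Fourier transform of an integrable function bounded
by `1 / 2`. -/
lemma exists_kernel {ν s τ : ℝ} (hν : 0 < ν) (hs : 0 ≤ s) (hτ : τ ≠ 0) :
    ∃ k : ℝ → ℂ, Integrable k ∧ (∀ y, ‖k y‖ ≤ 1 / 2) ∧
      ∀ ξ : ℝ, ∫ y : ℝ, e (-(y * ξ)) * k y =
        (ξ : ℂ) / ((ξ : ℂ) ^ 2 - Complex.I * (ν : ℂ) * ((ξ : ℂ) ^ 2 + (s : ℂ)) + (τ : ℂ)) := by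
  set a : ℂ := 1 - Complex.I * ν with ha
  have hare : a.re = 1 := by simp [ha]
  have hnorm : 1 ≤ ‖a‖ := by
    simpa [hare] using Complex.abs_re_le_norm a
  have ha0 : a ≠ 0 := fun h => by simp [h] at hare
  obtain ⟨w, hw⟩ := IsAlgClosed.exists_pow_nat_eq ((τ - Complex.I * ν * s) / a) (n := 2) (by norm_num)
  rw [eq_div_iff ha0] at hw
  have hwre : w.re ≠ 0 := fun h0 => by
    have hre := congrArg Complex.re hw
    have him := congrArg Complex.im hw
    simp [ha, sq, h0] at hre him
    have : ν * (w.im * w.im + s) = 0 := by linarith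
    have h1 : w.im * w.im + s = 0 := by simpa [hν.ne'] using this
    have h2 : w.im * w.im = 0 := by nlinarith [mul_self_nonneg w.im]
    exact hτ (by rw [← hre, h2, neg_zero])
  obtain ⟨z, hz, hzw⟩ : ∃ z : ℂ, 0 < z.re ∧ z ^ 2 * a = τ - Complex.I * ν * s := by
    rcases hwre.lt_or_gt with h | h
    · exact ⟨-w, by simpa using h, by rw [neg_sq, hw]⟩
    · exact ⟨w, h, hw⟩
  refine ⟨oddExpKernel a z, integrable_oddExpKernel a hz, norm_oddExpKernel_le hnorm hz,
    fun ξ => ?_⟩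
  rw [integral_e_mul_oddExpKernel ha0 hz]
  congr 1
  linear_combination (norm := (rw [ha]; ring)) hzw

lemma SchwartzMap.exists_norm_le_prod (f : SchwartzMap (ℝ × ℝ) ℂ) :
    ∃ C : ℝ, 0 ≤ C ∧ ∀ t y : ℝ, ‖f (t, y)‖ ≤ C * (1 + t ^ 2)⁻¹ * (1 + y ^ 2)⁻¹ := by
  refine ⟨2 ^ 4 * ((Finset.Iic (4, 0)).sup fun m => SchwartzMap.seminorm ℝ m.1 m.2) f,
    by positivity, fun t y => ?_⟩
  have h := SchwartzMap.one_add_le_sup_seminorm_apply (𝕜 := ℝ) (m := (4, 0)) (k := 4) (n := 0)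
    le_rfl le_rfl f (t, y)
  rw [norm_iteratedFDeriv_zero] at h
  refine le_trans ?_ (mul_le_mul_of_nonneg_right (mul_le_mul_of_nonneg_right h ?_) ?_)
  · have hsq : ∀ r : ℝ, |r| ≤ ‖(t, y)‖ → 1 + r ^ 2 ≤ (1 + ‖(t, y)‖) ^ 2 := fun r hr => by
      nlinarith [sq_abs r, abs_nonneg r]
    have ht := hsq t (norm_fst_le (t, y))
    have hy := hsq y (norm_snd_le (t, y))
    have hmul : (1 + t ^ 2) * (1 + y ^ 2) ≤ (1 + ‖(t, y)‖) ^ 4 := by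
      calc _ ≤ (1 + ‖(t, y)‖) ^ 2 * (1 + ‖(t, y)‖) ^ 2 :=
            mul_le_mul ht hy (by positivity) (by positivity)
        _ = _ := by ring
    rw [mul_assoc, ← mul_inv, ← div_eq_mul_inv, le_div_iff₀ (by positivity), mul_comm]
    exact mul_le_mul_of_nonneg_right hmul (norm_nonneg _)
  · positivity
  · positivity

/-- The Fourier transform of `f` in the first variable. -/
def partialFT (f : ℝ × ℝ → ℂ) (τ y : ℝ) : ℂ := ∫ t : ℝ, e (-(t * τ)) * f (t, y)

lemma SchwartzMap.integrable_slice (f : SchwartzMap (ℝ × ℝ) ℂ) (y : ℝ) :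
    Integrable fun t => f (t, y) := by
  obtain ⟨C, hC, hf⟩ := f.exists_norm_le_prod
  refine ((integrable_inv_one_add_sq.const_mul C).mul_const (1 + y ^ 2)⁻¹).mono'
    (by fun_prop) (Filter.Eventually.of_forall fun t => hf t y)

lemma continuous_partialFT (f : SchwartzMap (ℝ × ℝ) ℂ) :
    Continuous fun p : ℝ × ℝ => partialFT f p.1 p.2 := by
  obtain ⟨C, hC, hf⟩ := f.exists_norm_le_prod
  refine continuous_of_dominated (bound := fun t => C * (1 + t ^ 2)⁻¹) (fun p => ?_) (fun p => ?_)
    (integrable_inv_one_add_sq.const_mul C) ?_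
  · exact (integrable_e_mul (by fun_prop) (f.integrable_slice _)).aestronglyMeasurable
  · refine Filter.Eventually.of_forall fun t => ?_
    rw [norm_mul, norm_e, one_mul]
    refine (hf t p.2).trans (mul_le_of_le_one_right (by positivity) ?_)
    exact inv_le_one_of_one_le₀ (by nlinarith [sq_nonneg p.2])
  · exact Filter.Eventually.of_forall fun t => by fun_prop

lemma integrable_e_mul_prod (f : SchwartzMap (ℝ × ℝ) ℂ) (τ : ℝ) :
    Integrable (fun p : ℝ × ℝ => e (-(p.1 * τ)) * f p) (volume.prod volume) :=
  integrable_e_mul (by fun_prop) (f.integrable (μ := volume))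

lemma integrable_partialFT (f : SchwartzMap (ℝ × ℝ) ℂ) (τ : ℝ) : Integrable (partialFT f τ) :=
  (integrable_e_mul_prod f τ).integral_prod_right

lemma FT2_eq_integral_partialFT (f : SchwartzMap (ℝ × ℝ) ℂ) (τ ξ : ℝ) :
    FT2 f τ ξ = ∫ y : ℝ, e (-(y * ξ)) * partialFT f τ y := by
  have hint : Integrable (fun p : ℝ × ℝ => e (-(p.1 * τ + p.2 * ξ)) * f p) (volume.prod volume) :=
    integrable_e_mul (by fun_prop) (f.integrable (μ := volume))
  rw [FT2, Measure.volume_eq_prod, integral_prod_symm _ hint]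
  refine integral_congr_ae (Filter.Eventually.of_forall fun y => ?_)
  simp only [partialFT]
  rw [← integral_const_mul]
  refine integral_congr_ae (Filter.Eventually.of_forall fun t => ?_)
  simp only [neg_add, e_add]
  ring

lemma integrable_FT2 (f : SchwartzMap (ℝ × ℝ) ℂ) :
    Integrable fun q : ℝ × ℝ => FT2 f q.1 q.2 := by
  have hpi := Real.pi_pos
  have hne : (Real.pi : ℂ) ≠ 0 := by exact_mod_cast Real.pi_ne_zero
  let ψ : SchwartzMap ℂ ℂ :=
    SchwartzMap.compCLMOfContinuousLinearEquiv ℂ Complex.equivRealProdCLM f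
  have hint : Integrable fun w : ℂ => (𝓕 ψ) ((2 * Real.pi)⁻¹ • w) :=
    ((𝓕 ψ).integrable (μ := volume)).comp_smul (by positivity)
  rw [← Complex.volume_preserving_equiv_real_prod.integrable_comp_emb
    Complex.measurableEquivRealProd.measurableEmbedding]
  refine hint.congr (Filter.Eventually.of_forall fun w => ?_)
  simp only [Function.comp, SchwartzMap.fourier_coe, Real.fourier_eq', FT2]
  rw [← Complex.volume_preserving_equiv_real_prod.integral_comp
    Complex.measurableEquivRealProd.measurableEmbedding]
  refine integral_congr_ae (Filter.Eventually.of_forall fun v => ?_)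
  simp only [e, smul_eq_mul, ψ, SchwartzMap.compCLMOfContinuousLinearEquiv_apply, Function.comp,
    Complex.measurableEquivRealProd_apply, Complex.equivRealProdCLM_apply, Complex.inner,
    Complex.mul_re, Complex.conj_re, Complex.conj_im, Complex.smul_re, Complex.smul_im]
  congr 2
  push_cast
  field_simp
  ring

/-- Pointwise in `τ ≠ 0`, the `ξ`-integral defining `u` is controlled by the `L¹_x` norm of the
partial Fourier transform of `f`. -/
lemma enorm_integral_multiplier_le {ν s τ : ℝ} (hν : 0 < ν) (hs : 0 ≤ s) (hτ : τ ≠ 0)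
    (f : SchwartzMap (ℝ × ℝ) ℂ) (hF : Integrable fun ξ : ℝ => FT2 f τ ξ) (x : ℝ) :
    ‖∫ ξ : ℝ, e (x * ξ) *
        ((ξ : ℂ) / ((ξ : ℂ) ^ 2 - Complex.I * (ν : ℂ) * ((ξ : ℂ) ^ 2 + (s : ℂ)) + (τ : ℂ))) *
        FT2 f τ ξ‖ₑ
      ≤ ENNReal.ofReal Real.pi * ∫⁻ y, ‖partialFT f τ y‖ₑ := by
  obtain ⟨k, hk, hB, hkF⟩ := exists_kernel hν hs hτ
  simp only [← hkF]
  simp only [FT2_eq_integral_partialFT] at hF ⊢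
  have hc : Continuous (partialFT f τ) :=
    (continuous_partialFT f).comp (Continuous.prodMk_right τ)
  have h := norm_integral_e_mul_fourier_mul_le hk hB hc (integrable_partialFT f τ) hF x
  rw [← ofReal_integral_norm_eq_lintegral_enorm (integrable_partialFT f τ),
    ← ENNReal.ofReal_mul Real.pi_pos.le, ← ofReal_norm]
  exact ENNReal.ofReal_le_ofReal (h.trans_eq (by ring))

lemma lintegral_lintegral_partialFT_sq_le (f : SchwartzMap (ℝ × ℝ) ℂ) :
    ∫⁻ τ, (∫⁻ y, ‖partialFT f τ y‖ₑ) ^ 2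
      ≤ ENNReal.ofReal (2 * Real.pi) * (∫⁻ y, (∫⁻ t, ‖f (t, y)‖ₑ ^ 2) ^ (1 / 2 : ℝ)) ^ 2 := by
  have hm : Measurable fun y => (∫⁻ t, ‖f (t, y)‖ₑ ^ 2) ^ (1 / 2 : ℝ) := by
    refine Measurable.pow_const ?_ _
    exact Measurable.lintegral_prod_left' (f := fun p : ℝ × ℝ => ‖f p‖ₑ ^ 2)
      (f.continuous.measurable.enorm.pow_const 2)
  have hhalf : (ENNReal.ofReal (2 * Real.pi) ^ (1 / 2 : ℝ)) ^ 2 = ENNReal.ofReal (2 * Real.pi) := by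
    rw [← ENNReal.rpow_natCast, ← ENNReal.rpow_mul]
    norm_num
  have hP : ∀ y, (∫⁻ τ, ‖partialFT f τ y‖ₑ ^ 2) ^ (1 / 2 : ℝ) ≤
      ENNReal.ofReal (2 * Real.pi) ^ (1 / 2 : ℝ) * (∫⁻ t, ‖f (t, y)‖ₑ ^ 2) ^ (1 / 2 : ℝ) :=
    fun y => by
      rw [← ENNReal.mul_rpow_of_nonneg _ _ (by norm_num)]
      exact ENNReal.rpow_le_rpow (lintegral_integral_e_mul_sq_le (f.integrable_slice y))
        (by norm_num)
  calc ∫⁻ τ, (∫⁻ y, ‖partialFT f τ y‖ₑ) ^ 2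
      ≤ (∫⁻ y, (∫⁻ τ, ‖partialFT f τ y‖ₑ ^ 2) ^ (1 / 2 : ℝ)) ^ 2 :=
        lintegral_lintegral_sq_le (H := fun p => ‖partialFT f p.1 p.2‖ₑ)
          (continuous_partialFT f).measurable.enorm
    _ ≤ (∫⁻ y, ENNReal.ofReal (2 * Real.pi) ^ (1 / 2 : ℝ) *
          (∫⁻ t, ‖f (t, y)‖ₑ ^ 2) ^ (1 / 2 : ℝ)) ^ 2 :=
        pow_le_pow_left' (lintegral_mono hP) 2
    _ = _ := by rw [lintegral_const_mul _ hm, mul_pow, hhalf]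

lemma lintegral_uMul_sq_le {ν s : ℝ} (hν : 0 < ν) (hs : 0 ≤ s) (f : SchwartzMap (ℝ × ℝ) ℂ)
    (x : ℝ) :
    ∫⁻ t, ‖uMul ν s f t x‖ₑ ^ 2
      ≤ ENNReal.ofReal (1 / 4) * (∫⁻ y, (∫⁻ t, ‖f (t, y)‖ₑ ^ 2) ^ (1 / 2 : ℝ)) ^ 2 := by
  have hpi := Real.pi_pos
  set m : ℝ × ℝ → ℂ := fun q => (q.2 : ℂ) /
    ((q.2 : ℂ) ^ 2 - Complex.I * (ν : ℂ) * ((q.2 : ℂ) ^ 2 + (s : ℂ)) + (q.1 : ℂ)) with hm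
  set Φ : ℝ × ℝ → ℂ := fun q => e (x * q.2) * m q * FT2 f q.1 q.2 with hΦ
  have hu : ∀ t, uMul ν s f t x = ((2 * Real.pi) ^ 2)⁻¹ • ∫ q, e (t * q.1) * Φ q := fun t => by
    simp only [uMul, hΦ, hm, e_add, mul_assoc]
  by_cases hint : Integrable Φ
  swap
  · have hzero : ∀ t, uMul ν s f t x = 0 := fun t => by
      rw [hu, integral_undef, smul_zero]
      refine fun h => hint ?_
      refine (integrable_e_mul (φ := fun q : ℝ × ℝ => -(t * q.1)) (by fun_prop) h).congr
        (Filter.Eventually.of_forall fun q => ?_)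
      simp only
      rw [← mul_assoc, ← e_add, neg_add_cancel]
      simp [e]
    simp [hzero]
  set g : ℝ → ℂ := fun τ => ∫ ξ, Φ (τ, ξ) with hg
  have hgi : Integrable g := Integrable.integral_prod_left (f := Φ) hint
  have hug : ∀ t, uMul ν s f (-t) x = ((2 * Real.pi) ^ 2)⁻¹ • ∫ τ, e (-(τ * t)) * g τ := fun t => by
    rw [hu, Measure.volume_eq_prod, integral_prod _ (integrable_e_mul (by fun_prop) hint)]
    congr 1
    refine integral_congr_ae (Filter.Eventually.of_forall fun τ => ?_)
    simp only [hg]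
    rw [integral_const_mul, show -t * τ = -(τ * t) by ring]
  have hgb : ∀ᵐ τ, ‖g τ‖ₑ ≤ ENNReal.ofReal Real.pi * ∫⁻ y, ‖partialFT f τ y‖ₑ := by
    have h1 : ∀ᵐ τ : ℝ, Integrable fun ξ => FT2 f τ ξ :=
      Integrable.prod_right_ae (f := fun q : ℝ × ℝ => FT2 f q.1 q.2) (integrable_FT2 f)
    have h2 : ∀ᵐ τ : ℝ, τ ≠ 0 := Measure.ae_ne volume 0
    filter_upwards [h1, h2] with τ hF hτ
    exact enorm_integral_multiplier_le hν hs hτ f hF x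
  calc ∫⁻ t, ‖uMul ν s f t x‖ₑ ^ 2
      = ∫⁻ t, ‖uMul ν s f (-t) x‖ₑ ^ 2 := by
        have h := lintegral_comp_mul_left_real (fun t => ‖uMul ν s f t x‖ₑ ^ 2)
          (show (-1 : ℝ) ≠ 0 by norm_num)
        simpa using h.symm
    _ = ENNReal.ofReal (((2 * Real.pi) ^ 2)⁻¹) ^ 2 * ∫⁻ t, ‖∫ τ, e (-(τ * t)) * g τ‖ₑ ^ 2 := by
        rw [← lintegral_const_mul' _ _ (by finiteness)]
        refine lintegral_congr fun t => ?_
        rw [hug, enorm_smul, mul_pow, Real.enorm_of_nonneg (by positivity)]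
    _ ≤ ENNReal.ofReal (((2 * Real.pi) ^ 2)⁻¹) ^ 2 *
          (ENNReal.ofReal (2 * Real.pi) * ∫⁻ τ, ‖g τ‖ₑ ^ 2) := by
        gcongr _ * ?_
        exact lintegral_integral_e_mul_sq_le hgi
    _ ≤ ENNReal.ofReal (((2 * Real.pi) ^ 2)⁻¹) ^ 2 * (ENNReal.ofReal (2 * Real.pi) *
          (ENNReal.ofReal Real.pi ^ 2 * ∫⁻ τ, (∫⁻ y, ‖partialFT f τ y‖ₑ) ^ 2)) := by
        gcongr _ * (_ * ?_)
        rw [← lintegral_const_mul' _ _ (by finiteness)]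
        refine lintegral_mono_ae (hgb.mono fun τ h => ?_)
        rw [← mul_pow]
        gcongr
    _ ≤ ENNReal.ofReal (((2 * Real.pi) ^ 2)⁻¹) ^ 2 * (ENNReal.ofReal (2 * Real.pi) *
          (ENNReal.ofReal Real.pi ^ 2 * (ENNReal.ofReal (2 * Real.pi) *
            (∫⁻ y, (∫⁻ t, ‖f (t, y)‖ₑ ^ 2) ^ (1 / 2 : ℝ)) ^ 2))) := by
        gcongr _ * (_ * (_ * ?_))
        exact lintegral_lintegral_partialFT_sq_le f
    _ = _ := by
        simp only [← mul_assoc]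
        congr 1
        rw [← ENNReal.ofReal_pow (by positivity), ← ENNReal.ofReal_pow (by positivity),
          ← ENNReal.ofReal_mul (by positivity), ← ENNReal.ofReal_mul (by positivity),
          ← ENNReal.ofReal_mul (by positivity)]
        congr 1
        field_simp
        norm_num

lemma lintegral_lintegral_sq_rpow_eq (f : SchwartzMap (ℝ × ℝ) ℂ) :
    ∫⁻ y, (∫⁻ t, ‖f (t, y)‖ₑ ^ 2) ^ (1 / 2 : ℝ)
      = ENNReal.ofReal (∫ y : ℝ, (∫ t : ℝ, ‖f (t, y)‖ ^ 2) ^ ((1 : ℝ) / 2)) := by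
  obtain ⟨C, hC, hf⟩ := f.exists_norm_le_prod
  have hsq : ∀ t y : ℝ, ‖f (t, y)‖ ^ 2 ≤ (C * (1 + y ^ 2)⁻¹) ^ 2 * (1 + t ^ 2)⁻¹ := fun t y => by
    have h1 : (1 + t ^ 2)⁻¹ ≤ 1 := inv_le_one_of_one_le₀ (by nlinarith [sq_nonneg t])
    calc ‖f (t, y)‖ ^ 2 ≤ (C * (1 + t ^ 2)⁻¹ * (1 + y ^ 2)⁻¹) ^ 2 := by
          gcongr
          exact hf t y
      _ = (C * (1 + y ^ 2)⁻¹) ^ 2 * ((1 + t ^ 2)⁻¹ * (1 + t ^ 2)⁻¹) := by ring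
      _ ≤ (C * (1 + y ^ 2)⁻¹) ^ 2 * ((1 + t ^ 2)⁻¹ * 1) := by gcongr
      _ = _ := by rw [mul_one]
  have hslice : ∀ y : ℝ, Integrable fun t => ‖f (t, y)‖ ^ 2 := fun y =>
    (integrable_inv_one_add_sq.const_mul ((C * (1 + y ^ 2)⁻¹) ^ 2)).mono' (by fun_prop)
      (Filter.Eventually.of_forall fun t => by
        rw [Real.norm_of_nonneg (by positivity)]
        exact hsq t y)
  have hmeas : Measurable fun y : ℝ => (∫ t : ℝ, ‖f (t, y)‖ ^ 2) ^ ((1 : ℝ) / 2) := by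
    refine Measurable.pow_const ?_ _
    exact (StronglyMeasurable.integral_prod_left' (f := fun p : ℝ × ℝ => ‖f p‖ ^ 2)
      (by fun_prop : Continuous fun p : ℝ × ℝ => ‖f p‖ ^ 2).stronglyMeasurable).measurable
  have hint : Integrable fun y : ℝ => (∫ t : ℝ, ‖f (t, y)‖ ^ 2) ^ ((1 : ℝ) / 2) := by
    refine ((integrable_inv_one_add_sq.const_mul C).mul_const (Real.pi ^ ((1 : ℝ) / 2))).mono'
      hmeas.aestronglyMeasurable (Filter.Eventually.of_forall fun y => ?_)
    rw [Real.norm_of_nonneg (by positivity)]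
    have h1 : ∫ t : ℝ, ‖f (t, y)‖ ^ 2 ≤ (C * (1 + y ^ 2)⁻¹) ^ 2 * Real.pi := by
      refine (integral_mono (hslice y) (integrable_inv_one_add_sq.const_mul _)
        (fun t => hsq t y)).trans_eq ?_
      rw [integral_const_mul, integral_univ_inv_one_add_sq]
    calc _ ≤ ((C * (1 + y ^ 2)⁻¹) ^ 2 * Real.pi) ^ ((1 : ℝ) / 2) := by gcongr
      _ = _ := by
        rw [Real.mul_rpow (by positivity) Real.pi_pos.le, ← Real.sqrt_eq_rpow,
          Real.sqrt_sq (by positivity)]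
  rw [ofReal_integral_eq_lintegral_ofReal hint (Filter.Eventually.of_forall fun y => by positivity)]
  refine lintegral_congr fun y => ?_
  rw [← ENNReal.ofReal_rpow_of_nonneg (by positivity) (by norm_num),
    ofReal_integral_eq_lintegral_ofReal (hslice y)
      (Filter.Eventually.of_forall fun t => by positivity)]
  simp only [ENNReal.ofReal_pow (norm_nonneg _), ofReal_norm]

/-- uniform (in `ν > 0`, `s ≥ 0`) smoothing estimate for the multiplier
`ξ/(ξ² - iν(ξ² + s) + τ)`:  `‖u‖_{L^∞_x L²_t} ≤ C ‖f‖_{L¹_x L²_t}`. -/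
theorem stmt_2 :
    ∃ C : ℝ, 0 < C ∧
      ∀ (ν : ℝ), 0 < ν → ∀ (s : ℝ), 0 ≤ s →
      ∀ f : SchwartzMap (ℝ × ℝ) ℂ,
        ∀ᵐ x : ℝ ∂volume,
          (∫ t : ℝ, ‖uMul ν s (⇑f) t x‖ ^ 2) ^ ((1 : ℝ) / 2)
            ≤ C * ∫ x' : ℝ, (∫ t : ℝ, ‖f (t, x')‖ ^ 2) ^ ((1 : ℝ) / 2) := by
  refine ⟨1 / 2, by norm_num, fun ν hν s hs f => Filter.Eventually.of_forall fun x => ?_⟩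
  have hA : 0 ≤ ∫ x' : ℝ, (∫ t : ℝ, ‖f (t, x')‖ ^ 2) ^ ((1 : ℝ) / 2) :=
    integral_nonneg fun y => by positivity
  have hle := lintegral_uMul_sq_le hν hs f x
  rw [lintegral_lintegral_sq_rpow_eq] at hle
  set A := ∫ x' : ℝ, (∫ t : ℝ, ‖f (t, x')‖ ^ 2) ^ ((1 : ℝ) / 2)
  have hsq : ∫ t : ℝ, ‖uMul ν s f t x‖ ^ 2 ≤ (1 / 2 * A) ^ 2 := by
    by_cases hint : Integrable fun t : ℝ => ‖uMul ν s f t x‖ ^ 2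
    · rw [← ENNReal.ofReal_le_ofReal_iff (by positivity), ofReal_integral_eq_lintegral_ofReal hint
        (Filter.Eventually.of_forall fun t => by positivity)]
      simp only [ENNReal.ofReal_pow (norm_nonneg _), ofReal_norm]
      refine hle.trans_eq ?_
      rw [← ENNReal.ofReal_pow hA, ← ENNReal.ofReal_mul (by norm_num)]
      congr 1
      ring
    · rw [integral_undef hint]
      positivity
  rw [← Real.sqrt_eq_rpow]
  exact Real.sqrt_le_iff.2 ⟨by positivity, hsq⟩
end
end
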